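/- arXiv:2207.09180 — 2 statements merged into one kernel-verified Lean document; each statement's English description precedes it below -/
import Mathlib

section
/- The parallel composite of two slots is a slot: in a symmetric monoidal category C, if S is a slot of type [A₁,A₁'] → [A₂,A₂'] and T is a slot of type [B₁,B₁'] → [B₂,B₂'], then the family (S ⊡ T)_{X,X'}(φ) := S_{B₂⊗X,B₂'⊗X'}(ext(T)_{X,X'}(φ)), for φ : A₁ ⊗ B₁ ⊗ X ⟶ A₁' ⊗ B₁' ⊗ X' and ext(T) the (A₁,A₁')-extension of T, is a slot of type [A₁ ⊗ B₁, A₁' ⊗ B₁'] → [A₂ ⊗ B₂, A₂' ⊗ B₂'] (in particular it is a locally-applicable transformation of that type). -/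
open CategoryTheory MonoidalCategory

universe v u

variable {C : Type u} [Category.{v} C] [MonoidalCategory C] [SymmetricCategory C]

/-- A family of functions of type `[A,A'] → [B,B']`: for each pair of objects `X X'`,
a function from morphisms `A ⊗ X ⟶ A' ⊗ X'` to morphisms `B ⊗ X ⟶ B' ⊗ X'`. -/
def Fam (A A' B B' : C) : Type _ :=
  ∀ X X' : C, (A ⊗ X ⟶ A' ⊗ X') → (B ⊗ X ⟶ B' ⊗ X')

/-- A family is a locally-applicable transformation if it is natural in the extensions:
`S_{Y,Y'}((𝟙_{A'} ⊗ b) ∘ φ ∘ (𝟙_A ⊗ a)) = (𝟙_{B'} ⊗ b) ∘ S_{X,X'}(φ) ∘ (𝟙_B ⊗ a)`. -/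
def IsLAT {A A' B B' : C} (S : Fam A A' B B') : Prop :=
  ∀ {X X' Y Y' : C} (a : Y ⟶ X) (b : X' ⟶ Y') (φ : A ⊗ X ⟶ A' ⊗ X'),
    S Y Y' ((A ◁ a) ≫ φ ≫ (A' ◁ b)) = (B ◁ a) ≫ S X X' φ ≫ (B' ◁ b)

/-- The comb family `Comb(u,d)` of type `[A,A'] → [B,B']` determined by
`u : B ⟶ A ⊗ M` and `d : A' ⊗ M ⟶ B'`:
`Comb(u,d)_{X,X'}(φ) = (d ⊗ 𝟙_{X'}) ∘ (𝟙_{A'} ⊗ β_{X',M}) ∘ (φ ⊗ 𝟙_M) ∘ (𝟙_A ⊗ β_{M,X}) ∘ (u ⊗ 𝟙_X)`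
(associators inserted). -/
def comb {A A' B B' M : C} (u : B ⟶ A ⊗ M) (d : A' ⊗ M ⟶ B') : Fam A A' B B' :=
  fun X X' φ =>
    (u ▷ X) ≫ (α_ A M X).hom ≫ (A ◁ (β_ M X).hom) ≫ (α_ A X M).inv ≫
      (φ ▷ M) ≫ (α_ A' X' M).hom ≫ (A' ◁ (β_ X' M).hom) ≫ (α_ A' M X').inv ≫ (d ▷ X')


/-- The `(A,A')`-extension of a family `T` of type `[B₁,B₁'] → [B₂,B₂']`:
`ext(T)_{X,X'}(ψ) = (β_{B₂',A'} ⊗ 𝟙_{X'}) ∘ T_{A⊗X,A'⊗X'}((β_{A',B₁'} ⊗ 𝟙_{X'}) ∘ ψ ∘ (β_{B₁,A} ⊗ 𝟙_X)) ∘ (β_{A,B₂} ⊗ 𝟙_X)`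
(associators inserted; `T` is applied with extension objects `A ⊗ X` and `A' ⊗ X'`). -/
def ext {B₁ B₁' B₂ B₂' : C} (A A' : C) (T : Fam B₁ B₁' B₂ B₂') :
    ∀ X X' : C, ((A ⊗ B₁) ⊗ X ⟶ (A' ⊗ B₁') ⊗ X') → ((A ⊗ B₂) ⊗ X ⟶ (A' ⊗ B₂') ⊗ X') :=
  fun X X' ψ =>
    ((β_ A B₂).hom ▷ X) ≫ (α_ B₂ A X).hom ≫
      T (A ⊗ X) (A' ⊗ X')
        ((α_ B₁ A X).inv ≫ ((β_ B₁ A).hom ▷ X) ≫ ψ ≫ ((β_ A' B₁').hom ▷ X') ≫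
          (α_ B₁' A' X').hom) ≫
      (α_ B₂' A' X').inv ≫ ((β_ B₂' A').hom ▷ X')

/-- Application of a family `S` of type `[A₁,A₁'] → [A₂,A₂']` with extension objects
`B ⊗ X` and `B' ⊗ X'`, reassociated so that it acts on morphisms
`(A₁ ⊗ B) ⊗ X ⟶ (A₁' ⊗ B') ⊗ X'`. -/
def onPair {A₁ A₁' A₂ A₂' : C} (S : Fam A₁ A₁' A₂ A₂') (B B' X X' : C)
    (φ : (A₁ ⊗ B) ⊗ X ⟶ (A₁' ⊗ B') ⊗ X') : (A₂ ⊗ B) ⊗ X ⟶ (A₂' ⊗ B') ⊗ X' :=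
  (α_ A₂ B X).hom ≫
    S (B ⊗ X) (B' ⊗ X') ((α_ A₁ B X).inv ≫ φ ≫ (α_ A₁' B' X').hom) ≫
    (α_ A₂' B' X').inv

/-- A slot is a locally-applicable transformation which commutes with the extension of
every other locally-applicable transformation acting on a complementary tensor factor. -/
def IsSlot {A₁ A₁' A₂ A₂' : C} (S : Fam A₁ A₁' A₂ A₂') : Prop :=
  IsLAT S ∧
    ∀ {B₁ B₁' B₂ B₂' : C} (T : Fam B₁ B₁' B₂ B₂'), IsLAT T →
      ∀ (X X' : C) (φ : (A₁ ⊗ B₁) ⊗ X ⟶ (A₁' ⊗ B₁') ⊗ X'),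
        ext A₂ A₂' T X X' (onPair S B₁ B₁' X X' φ) =
          onPair S B₂ B₂' X X' (ext A₁ A₁' T X X' φ)

/-- The parallel composite `S ⊡ T` of a family `S` of type `[A₁,A₁'] → [A₂,A₂']` and a
family `T` of type `[B₁,B₁'] → [B₂,B₂']`:
`(S ⊡ T)_{X,X'}(φ) := S_{B₂⊗X,B₂'⊗X'}(ext(T)_{X,X'}(φ))` where `ext(T)` is the
`(A₁,A₁')`-extension of `T`. -/
def boxTimes {A₁ A₁' A₂ A₂' B₁ B₁' B₂ B₂' : C}
    (S : Fam A₁ A₁' A₂ A₂') (T : Fam B₁ B₁' B₂ B₂') :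
    Fam (A₁ ⊗ B₁) (A₁' ⊗ B₁') (A₂ ⊗ B₂) (A₂' ⊗ B₂') :=
  fun X X' φ => onPair S B₂ B₂' X X' (ext A₁ A₁' T X X' φ)

set_option linter.unusedSectionVars false

/-- Apply a family after transporting along isomorphisms. -/
def appIso {D₁ D₁' D₂ D₂' : C} (R : Fam D₁ D₁' D₂ D₂') {P₁ P₁' P₂ P₂' Z Z' : C}
    (p₁ : P₁ ≅ D₁ ⊗ Z) (p₁' : P₁' ≅ D₁' ⊗ Z') (p₂ : P₂ ≅ D₂ ⊗ Z) (p₂' : P₂' ≅ D₂' ⊗ Z')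
    (φ : P₁ ⟶ P₁') : P₂ ⟶ P₂' :=
  p₂.hom ≫ R Z Z' (p₁.inv ≫ φ ≫ p₁'.hom) ≫ p₂'.inv

theorem appIso_move {D₁ D₁' D₂ D₂' : C} {R : Fam D₁ D₁' D₂ D₂'} (hR : IsLAT R)
    {P₁ P₁' P₂ P₂' Z Z' W W' : C}
    (p₁ : P₁ ≅ D₁ ⊗ Z) (p₁' : P₁' ≅ D₁' ⊗ Z') (p₂ : P₂ ≅ D₂ ⊗ Z) (p₂' : P₂' ≅ D₂' ⊗ Z')
    (e : Z ≅ W) (e' : Z' ≅ W') (φ : P₁ ⟶ P₁') :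
    appIso R p₁ p₁' p₂ p₂' φ =
      appIso R (p₁ ≪≫ whiskerLeftIso D₁ e) (p₁' ≪≫ whiskerLeftIso D₁' e')
        (p₂ ≪≫ whiskerLeftIso D₂ e) (p₂' ≪≫ whiskerLeftIso D₂' e') φ := by
  have h := hR e.inv e'.hom (p₁.inv ≫ φ ≫ p₁'.hom)
  simp only [appIso, Iso.trans_hom, Iso.trans_inv, whiskerLeftIso_hom, whiskerLeftIso_inv,
    Category.assoc] at h ⊢
  rw [h]
  simp

/-- The isomorphism used by `ext`. -/
def extIso (A B X : C) : (A ⊗ B) ⊗ X ≅ B ⊗ (A ⊗ X) :=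
  whiskerRightIso (β_ A B) X ≪≫ α_ B A X

theorem ext_eq {B₁ B₁' B₂ B₂' : C} (A A' : C) (T : Fam B₁ B₁' B₂ B₂') (X X' : C)
    (ψ : (A ⊗ B₁) ⊗ X ⟶ (A' ⊗ B₁') ⊗ X') :
    ext A A' T X X' ψ =
      appIso T (extIso A B₁ X) (extIso A' B₁' X') (extIso A B₂ X) (extIso A' B₂' X') ψ := by
  have h : ∀ P Q : C, (β_ P Q).inv = (β_ Q P).hom := fun P Q => by
    rw [← cancel_epi (β_ P Q).hom]; simp
  simp [ext, appIso, extIso, h]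

theorem onPair_eq {A₁ A₁' A₂ A₂' : C} (S : Fam A₁ A₁' A₂ A₂') (B B' X X' : C)
    (φ : (A₁ ⊗ B) ⊗ X ⟶ (A₁' ⊗ B') ⊗ X') :
    onPair S B B' X X' φ = appIso S (α_ _ _ _) (α_ _ _ _) (α_ _ _ _) (α_ _ _ _) φ := rfl

/-- `ext` as a family. -/
def extFam {B₁ B₁' B₂ B₂' : C} (A A' : C) (T : Fam B₁ B₁' B₂ B₂') :
    Fam (A ⊗ B₁) (A' ⊗ B₁') (A ⊗ B₂) (A' ⊗ B₂') :=
  fun X X' ψ => ext A A' T X X' ψ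

theorem extFam_apply {B₁ B₁' B₂ B₂' : C} (A A' : C) (T : Fam B₁ B₁' B₂ B₂') (X X' : C)
    (ψ : (A ⊗ B₁) ⊗ X ⟶ (A' ⊗ B₁') ⊗ X') :
    extFam A A' T X X' ψ = ext A A' T X X' ψ := rfl

theorem extIso_natural (A B : C) {X Y : C} (a : Y ⟶ X) :
    (A ⊗ B) ◁ a ≫ (extIso A B X).hom = (extIso A B Y).hom ≫ B ◁ A ◁ a := by
  simp only [extIso, Iso.trans_hom, whiskerRightIso_hom, Category.assoc]
  rw [whisker_exchange_assoc]
  simp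

theorem extIso_natural_inv (A B : C) {X Y : C} (a : Y ⟶ X) :
    (extIso A B Y).inv ≫ (A ⊗ B) ◁ a = B ◁ A ◁ a ≫ (extIso A B X).inv := by
  rw [Iso.inv_comp_eq, ← Category.assoc, Iso.eq_comp_inv, extIso_natural]

theorem ext_isLAT {B₁ B₁' B₂ B₂' : C} (A A' : C) {T : Fam B₁ B₁' B₂ B₂'} (hT : IsLAT T) :
    IsLAT (extFam A A' T) := by
  intro X X' Y Y' a b φ
  have h := hT (A ◁ a) (A' ◁ b) ((extIso A B₁ X).inv ≫ φ ≫ (extIso A' B₁' X').hom)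
  rw [extFam_apply, extFam_apply, ext_eq, ext_eq]
  simp only [appIso]
  have e1 : (extIso A B₁ Y).inv ≫ ((A ⊗ B₁) ◁ a ≫ φ ≫ (A' ⊗ B₁') ◁ b) ≫ (extIso A' B₁' Y').hom
      = B₁ ◁ A ◁ a ≫ ((extIso A B₁ X).inv ≫ φ ≫ (extIso A' B₁' X').hom) ≫ B₁' ◁ A' ◁ b := by
    simp only [Category.assoc, extIso_natural, reassoc_of% (extIso_natural_inv A B₁ a)]
  rw [e1, h]
  simp only [Category.assoc, extIso_natural_inv, reassoc_of% (extIso_natural A B₂ a)]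

theorem onPair_natural {A₁ A₁' A₂ A₂' : C} {S : Fam A₁ A₁' A₂ A₂'} (hS : IsLAT S)
    (B B' : C) {X X' Y Y' : C} (a : Y ⟶ X) (b : X' ⟶ Y')
    (φ : (A₁ ⊗ B) ⊗ X ⟶ (A₁' ⊗ B') ⊗ X') :
    onPair S B B' Y Y' ((A₁ ⊗ B) ◁ a ≫ φ ≫ (A₁' ⊗ B') ◁ b) =
      (A₂ ⊗ B) ◁ a ≫ onPair S B B' X X' φ ≫ (A₂' ⊗ B') ◁ b := by
  have h := hS (B ◁ a) (B' ◁ b) ((α_ _ _ _).inv ≫ φ ≫ (α_ _ _ _).hom)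
  have e1 : (α_ A₁ B Y).inv ≫ ((A₁ ⊗ B) ◁ a ≫ φ ≫ (A₁' ⊗ B') ◁ b) ≫ (α_ A₁' B' Y').hom
      = A₁ ◁ B ◁ a ≫ ((α_ _ _ _).inv ≫ φ ≫ (α_ _ _ _).hom) ≫ A₁' ◁ B' ◁ b := by
    simp
  simp only [onPair]
  rw [e1, h]
  simp

theorem boxTimes_isLAT {A₁ A₁' A₂ A₂' B₁ B₁' B₂ B₂' : C}
    {S : Fam A₁ A₁' A₂ A₂'} {T : Fam B₁ B₁' B₂ B₂'} (hS : IsLAT S) (hT : IsLAT T) :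
    IsLAT (boxTimes S T) := by
  intro X X' Y Y' a b φ
  have h := ext_isLAT A₁ A₁' hT a b φ
  rw [extFam_apply, extFam_apply] at h
  simp only [boxTimes]
  rw [h, onPair_natural hS]

/-- Move `A` past `B ⊗ D`. -/
def jIso (A B D X : C) : ((A ⊗ B) ⊗ D) ⊗ X ≅ (B ⊗ D) ⊗ (A ⊗ X) :=
  whiskerRightIso (α_ A B D) X ≪≫ extIso A (B ⊗ D) X

theorem coh₁ (A B D X : C) :
    extIso (A ⊗ B) D X ≪≫ whiskerLeftIso D (extIso A B X) =
      jIso A B D X ≪≫ extIso B D (A ⊗ X) := by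
  ext
  simp [jIso, extIso, BraidedCategory.braiding_tensor_left_hom,
    BraidedCategory.braiding_tensor_right_hom]
  have h := congrArg (fun f => (α_ A B D).hom ▷ X ≫ f ▷ X ≫ (α_ D (B ⊗ A) X).hom ≫
    D ◁ (α_ B A X).hom) (BraidedCategory.yang_baxter A B D)
  simp at h
  exact h.symm

theorem coh₂ (A B D X : C) :
    (α_ (A ⊗ B) D X ≪≫ extIso A B (D ⊗ X)) ≪≫
      whiskerLeftIso B ((α_ A D X).symm ≪≫ extIso A D X) =
      jIso A B D X ≪≫ α_ B D (A ⊗ X) := by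
  ext
  simp [jIso, extIso, BraidedCategory.braiding_tensor_right_hom]

theorem ext_tensor {D₁ D₁' D₂ D₂' : C} {R : Fam D₁ D₁' D₂ D₂'} (hR : IsLAT R)
    (A A' B B' X X' : C) (φ : ((A ⊗ B) ⊗ D₁) ⊗ X ⟶ ((A' ⊗ B') ⊗ D₁') ⊗ X') :
    ext (A ⊗ B) (A' ⊗ B') R X X' φ =
      (jIso A B D₂ X).hom ≫ ext B B' R (A ⊗ X) (A' ⊗ X')
        ((jIso A B D₁ X).inv ≫ φ ≫ (jIso A' B' D₁' X').hom) ≫ (jIso A' B' D₂' X').inv := by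
  rw [ext_eq, appIso_move hR _ _ _ _ (extIso A B X) (extIso A' B' X')]
  simp only [coh₁]
  rw [ext_eq]
  simp [appIso]

theorem ext_ext {D₁ D₁' D₂ D₂' : C} {R : Fam D₁ D₁' D₂ D₂'} (hR : IsLAT R)
    (A A' B B' X X' : C) (φ : ((A ⊗ B) ⊗ D₁) ⊗ X ⟶ ((A' ⊗ B') ⊗ D₁') ⊗ X') :
    ext (A ⊗ B) (A' ⊗ B') R X X' φ =
      (α_ A B D₂).hom ▷ X ≫ ext A A' (extFam B B' R) X X'
        ((α_ A B D₁).inv ▷ X ≫ φ ≫ (α_ A' B' D₁').hom ▷ X') ≫ (α_ A' B' D₂').inv ▷ X' := by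
  rw [ext_tensor hR, ext_eq A A']
  simp [appIso, jIso, extFam_apply]

theorem onPair_ext {B₁ B₁' B₂ B₂' : C} {T : Fam B₁ B₁' B₂ B₂'} (hT : IsLAT T)
    (A A' D D' X X' : C) (φ : ((A ⊗ B₁) ⊗ D) ⊗ X ⟶ ((A' ⊗ B₁') ⊗ D') ⊗ X') :
    onPair (extFam A A' T) D D' X X' φ =
      (jIso A B₂ D X).hom ≫ onPair T D D' (A ⊗ X) (A' ⊗ X')
        ((jIso A B₁ D X).inv ≫ φ ≫ (jIso A' B₁' D' X').hom) ≫ (jIso A' B₂' D' X').inv := by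
  have h : onPair (extFam A A' T) D D' X X' φ =
      appIso T (α_ _ _ _ ≪≫ extIso _ _ _) (α_ _ _ _ ≪≫ extIso _ _ _)
        (α_ _ _ _ ≪≫ extIso _ _ _) (α_ _ _ _ ≪≫ extIso _ _ _) φ := by
    simp only [onPair, extFam_apply, ext_eq]
    simp [appIso]
  rw [h, appIso_move hT _ _ _ _ ((α_ A D X).symm ≪≫ extIso A D X)
    ((α_ A' D' X').symm ≪≫ extIso A' D' X')]
  simp only [coh₂]
  simp [appIso, onPair]

theorem ext_isSlot {B₁ B₁' B₂ B₂' : C} (A A' : C) {T : Fam B₁ B₁' B₂ B₂'} (hT : IsSlot T) :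
    IsSlot (extFam A A' T) := by
  refine ⟨ext_isLAT A A' hT.1, ?_⟩
  intro D₁ D₁' D₂ D₂' R hR X X' φ
  rw [ext_tensor hR, ext_tensor hR, onPair_ext hT.1, onPair_ext hT.1]
  simp [hT.2 R hR]

theorem pent (A B D X : C) :
    (α_ (A ⊗ B) D X ≪≫ α_ A B (D ⊗ X)) ≪≫ whiskerLeftIso A (α_ B D X).symm =
      whiskerRightIso (α_ A B D) X ≪≫ α_ A (B ⊗ D) X := by
  ext
  simp

theorem onPair_boxTimes {A₁ A₁' A₂ A₂' B₁ B₁' B₂ B₂' : C}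
    {S : Fam A₁ A₁' A₂ A₂'} (T : Fam B₁ B₁' B₂ B₂') (hS : IsLAT S) (D D' X X' : C)
    (φ : ((A₁ ⊗ B₁) ⊗ D) ⊗ X ⟶ ((A₁' ⊗ B₁') ⊗ D') ⊗ X') :
    onPair (boxTimes S T) D D' X X' φ =
      (α_ A₂ B₂ D).hom ▷ X ≫ onPair S (B₂ ⊗ D) (B₂' ⊗ D') X X'
        ((α_ A₁ B₂ D).inv ▷ X ≫ onPair (extFam A₁ A₁' T) D D' X X' φ ≫
          (α_ A₁' B₂' D').hom ▷ X') ≫ (α_ A₂' B₂' D').inv ▷ X' := by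
  have h : onPair (boxTimes S T) D D' X X' φ =
      appIso S (α_ _ _ _ ≪≫ α_ _ _ _) (α_ _ _ _ ≪≫ α_ _ _ _)
        (α_ _ _ _ ≪≫ α_ _ _ _) (α_ _ _ _ ≪≫ α_ _ _ _)
        (onPair (extFam A₁ A₁' T) D D' X X' φ) := by
    simp [onPair, boxTimes, appIso, extFam_apply]
  rw [h, appIso_move hS _ _ _ _ (α_ B₂ D X).symm (α_ B₂' D' X').symm]
  simp only [pent]
  generalize onPair (extFam A₁ A₁' T) D D' X X' φ = ψ
  simp [appIso, onPair]

/-- The parallel composite of two slots is a slot (in particular, a locally-applicable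
transformation) of type `[A₁ ⊗ B₁, A₁' ⊗ B₁'] → [A₂ ⊗ B₂, A₂' ⊗ B₂']`. -/
theorem boxTimes_isSlot {A₁ A₁' A₂ A₂' B₁ B₁' B₂ B₂' : C}
    (S : Fam A₁ A₁' A₂ A₂') (T : Fam B₁ B₁' B₂ B₂')
    (hS : IsSlot S) (hT : IsSlot T) :
    IsSlot (boxTimes S T) := by
  refine ⟨boxTimes_isLAT hS.1 hT.1, ?_⟩
  intro D₁ D₁' D₂ D₂' R hR X X' φ
  have h1 := fun ψ => hS.2 _ (ext_isLAT B₂ B₂' hR) X X' ψ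
  have h2 := (ext_isSlot A₁ A₁' hT).2 R hR X X' φ
  rw [onPair_boxTimes T hS.1, onPair_boxTimes T hS.1, ← h2, ext_ext hR, ext_ext hR]
  simp [h1]
end

section
/- P-supermaps are closed under sequential composition: let P be a symmetric monoidal category, A, B, D objects with right duals Aᘁ, Bᘁ, Dᘁ, A', B', D' objects, and Q a class of morphisms of P containing all identities and closed under composition. If S : Aᘁ ⊗ A' ⟶ Bᘁ ⊗ B' is a P-supermap on Q of type [A,A'] → [B,B'] and T : Bᘁ ⊗ B' ⟶ Dᘁ ⊗ D' is a P-supermap on Q of type [B,B'] → [D,D'], then T ∘ S is a P-supermap on Q of type [A,A'] → [D,D']. -/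
open CategoryTheory MonoidalCategory

universe v u

variable {P : Type u} [Category.{v} P] [MonoidalCategory P] [SymmetricCategory P]

/-- The family `F(S)` induced by a morphism `S : Aᘁ ⊗ A' ⟶ Bᘁ ⊗ B'` between dual pairs:
`F(S)_{X,X'}(φ) = (𝟙_{B'⊗X'} ⊗ ε_B) ∘ (β_{Bᘁ,B'⊗X'} ⊗ 𝟙_B) ∘ (S ⊗ 𝟙_{X'⊗B}) ∘
(β_{A'⊗X',Aᘁ} ⊗ 𝟙_B) ∘ (φ ⊗ 𝟙_{Aᘁ⊗B}) ∘ (𝟙_A ⊗ β_{Aᘁ⊗B,X}) ∘ (η_A ⊗ 𝟙_{B⊗X})`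
(associators and unitors inserted). -/
def Fmap (A Ad A' B Bd B' : P) [ExactPairing A Ad] [ExactPairing B Bd]
    (S : Ad ⊗ A' ⟶ Bd ⊗ B') (X X' : P) (φ : A ⊗ X ⟶ A' ⊗ X') : B ⊗ X ⟶ B' ⊗ X' :=
  (λ_ (B ⊗ X)).inv ≫ ((η_ A Ad) ▷ (B ⊗ X)) ≫
    (α_ A Ad (B ⊗ X)).hom ≫ (A ◁ (α_ Ad B X).inv) ≫
    (A ◁ (β_ (Ad ⊗ B) X).hom) ≫ (α_ A X (Ad ⊗ B)).inv ≫
    (φ ▷ (Ad ⊗ B)) ≫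
    (α_ (A' ⊗ X') Ad B).inv ≫ ((β_ (A' ⊗ X') Ad).hom ▷ B) ≫
    ((α_ Ad A' X').inv ▷ B) ≫ (α_ (Ad ⊗ A') X' B).hom ≫
    (S ▷ (X' ⊗ B)) ≫
    (α_ (Bd ⊗ B') X' B).inv ≫ ((α_ Bd B' X').hom ▷ B) ≫
    ((β_ Bd (B' ⊗ X')).hom ▷ B) ≫ (α_ (B' ⊗ X') Bd B).hom ≫
    ((B' ⊗ X') ◁ (ε_ B Bd)) ≫ (ρ_ (B' ⊗ X')).hom

/-- A morphism `S : Aᘁ ⊗ A' ⟶ Bᘁ ⊗ B'` is a `P`-supermap on a class `Q` of morphisms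
if the induced family `F(S)` sends extended morphisms in `Q` to morphisms in `Q`. -/
def IsSupermap (Q : MorphismProperty P) (A Ad A' B Bd B' : P)
    [ExactPairing A Ad] [ExactPairing B Bd] (S : Ad ⊗ A' ⟶ Bd ⊗ B') : Prop :=
  ∀ (X X' : P) (φ : A ⊗ X ⟶ A' ⊗ X'), Q φ → Q (Fmap A Ad A' B Bd B' S X X' φ)

/-- Currying against the swapped duality. -/
def curryD (A Ad : P) [ExactPairing A Ad] {X Y : P} (φ : A ⊗ X ⟶ Y) : X ⟶ Ad ⊗ Y :=
  (λ_ X).inv ≫ (η_ A Ad ≫ (β_ Ad A).inv) ▷ X ≫ (α_ Ad A X).hom ≫ Ad ◁ φ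

/-- Uncurrying against the swapped duality. -/
def uncurryD (B Bd : P) [ExactPairing B Bd] {X Y : P} (g : X ⟶ Bd ⊗ Y) : B ⊗ X ⟶ Y :=
  B ◁ g ≫ (α_ B Bd Y).inv ≫ ((β_ B Bd).hom ≫ ε_ B Bd) ▷ Y ≫ (λ_ Y).hom

theorem curryD_uncurryD (B Bd : P) [ExactPairing B Bd] {X Y : P} (g : X ⟶ Bd ⊗ Y) :
    curryD B Bd (uncurryD B Bd g) = g := by
  letI : ExactPairing Bd B := BraidedCategory.exactPairing_swap B Bd
  have h := (tensorLeftHomEquiv X Bd B Y).apply_symm_apply g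
  simp only [tensorLeftHomEquiv, Equiv.coe_fn_mk, Equiv.coe_fn_symm_mk] at h
  exact h

theorem first_part (A Ad B : P) [ExactPairing A Ad] {X Y : P} (φ : A ⊗ X ⟶ Y) :
    (λ_ (B ⊗ X)).inv ≫ ((η_ A Ad) ▷ (B ⊗ X)) ≫
    (α_ A Ad (B ⊗ X)).hom ≫ (A ◁ (α_ Ad B X).inv) ≫
    (A ◁ (β_ (Ad ⊗ B) X).hom) ≫ (α_ A X (Ad ⊗ B)).inv ≫
    (φ ▷ (Ad ⊗ B)) ≫
    (α_ Y Ad B).inv ≫ ((β_ Y Ad).hom ▷ B)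
    = (β_ B X).hom ≫ curryD A Ad φ ▷ B := by
  have inner : curryD A Ad φ = (λ_ X).inv ≫ η_ A Ad ▷ X ≫ (α_ A Ad X).hom ≫
      A ◁ (β_ Ad X).hom ≫ (α_ A X Ad).inv ≫ φ ▷ Ad ≫ (β_ Y Ad).hom := by
    rw [BraidedCategory.braiding_naturality_left, BraidedCategory.braiding_tensor_left_hom]
    simp [curryD, ← SymmetricCategory.braiding_swap_eq_inv_braiding,
      ← whiskerLeft_comp_assoc]
  rw [inner, BraidedCategory.braiding_tensor_left_hom]
  have e : (β_ B X).hom ≫ (λ_ (X ⊗ B)).inv ≫ η_ A Ad ▷ (X ⊗ B) =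
      (λ_ (B ⊗ X)).inv ≫ η_ A Ad ▷ (B ⊗ X) ≫ (A ⊗ Ad) ◁ (β_ B X).hom := by
    rw [← whisker_exchange]; simp
  calc _ = ((λ_ (B ⊗ X)).inv ≫ η_ A Ad ▷ (B ⊗ X) ≫ (A ⊗ Ad) ◁ (β_ B X).hom) ⊗≫
        A ◁ (β_ Ad X).hom ▷ B ⊗≫ φ ▷ Ad ▷ B ⊗≫ (β_ Y Ad).hom ▷ B := by monoidal
    _ = _ := by rw [← e]; monoidal

theorem last_part (B Bd : P) [ExactPairing B Bd] {X Y : P} (g : X ⟶ Bd ⊗ Y) :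
    (β_ B X).hom ≫ g ▷ B ≫ ((β_ Bd Y).hom ▷ B) ≫ (α_ Y Bd B).hom ≫
    (Y ◁ (ε_ B Bd)) ≫ (ρ_ Y).hom = uncurryD B Bd g := by
  have e : (β_ (Bd ⊗ B) Y).hom ≫ Y ◁ ε_ B Bd ≫ (ρ_ Y).hom = ε_ B Bd ▷ Y ≫ (λ_ Y).hom := by
    rw [← BraidedCategory.braiding_naturality_left_assoc]; simp
  rw [← BraidedCategory.braiding_naturality_right_assoc, uncurryD, comp_whiskerRight,
    Category.assoc, ← e, BraidedCategory.braiding_tensor_left_hom,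
    BraidedCategory.braiding_tensor_right_hom]
  monoidal

theorem Fmap_eq (A Ad A' B Bd B' : P) [ExactPairing A Ad] [ExactPairing B Bd]
    (S : Ad ⊗ A' ⟶ Bd ⊗ B') (X X' : P) (φ : A ⊗ X ⟶ A' ⊗ X') :
    Fmap A Ad A' B Bd B' S X X' φ = uncurryD B Bd
      (curryD A Ad φ ≫ (α_ Ad A' X').inv ≫ S ▷ X' ≫ (α_ Bd B' X').hom) := by
  have h := first_part A Ad B φ
  rw [← last_part, comp_whiskerRight, Category.assoc, ← reassoc_of% h, Fmap]
  monoidal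

theorem Fmap_comp (A Ad A' B Bd B' D Dd D' : P)
    [ExactPairing A Ad] [ExactPairing B Bd] [ExactPairing D Dd]
    (S : Ad ⊗ A' ⟶ Bd ⊗ B') (T : Bd ⊗ B' ⟶ Dd ⊗ D') (X X' : P) (φ : A ⊗ X ⟶ A' ⊗ X') :
    Fmap A Ad A' D Dd D' (S ≫ T) X X' φ =
      Fmap B Bd B' D Dd D' T X X' (Fmap A Ad A' B Bd B' S X X' φ) := by
  simp [Fmap_eq, curryD_uncurryD]

/-- `P`-supermaps are closed under sequential composition: if `Q` contains all
identities and is closed under composition, the composite of a `P`-supermap of type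
`[A,A'] → [B,B']` with one of type `[B,B'] → [D,D']` is a `P`-supermap of type
`[A,A'] → [D,D']`. -/
theorem isSupermap_comp (Q : MorphismProperty P)
    (hid : ∀ X : P, Q (𝟙 X))
    (hcomp : ∀ {X Y Z : P} (f : X ⟶ Y) (g : Y ⟶ Z), Q f → Q g → Q (f ≫ g))
    (A Ad A' B Bd B' D Dd D' : P)
    [ExactPairing A Ad] [ExactPairing B Bd] [ExactPairing D Dd]
    (S : Ad ⊗ A' ⟶ Bd ⊗ B') (T : Bd ⊗ B' ⟶ Dd ⊗ D')
    (hS : IsSupermap Q A Ad A' B Bd B' S) (hT : IsSupermap Q B Bd B' D Dd D' T) :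
    IsSupermap Q A Ad A' D Dd D' (S ≫ T) := by
  intro X X' φ hφ
  rw [Fmap_comp A Ad A' B Bd B' D Dd D']
  exact hT X X' _ (hS X X' φ hφ)
end
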